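/- arXiv:1208.5694 — 3 statements merged into one kernel-verified Lean document; each statement's English description precedes it below -/
import Mathlib

section
/- Let S be a compact metric space, P : S → S a continuous map, Z a compact metric space, π : S → Z a continuous surjection, and g : Z → Z a measurable map with π ∘ P = g ∘ π. Suppose there is θ ∈ (0,1) such that d(P(x), P(y)) ≤ θ · d(x, y) whenever π(x) = π(y) (uniform contraction along fibers). Let ν be a Borel probability measure on S whose pushforward π_*ν is g-invariant. Then for every continuous function φ : S → ℝ, the sequence n ↦ ∫ φ d(P^n_*ν) = ∫ (φ ∘ P^n) dν is a Cauchy sequence of real numbers; consequently the sequence of pushforward measures (P^n_*ν)_{n≥1} converges in the weak* topology to a Borel probability measure on S. -/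
open MeasureTheory Filter Topology

/-- A continuous surjection `π` from a compact space has a section along which a given continuous
function is measurable, namely any section picking a maximizer on each fiber. -/
theorem exists_rightInverse_measurable_comp {S Z : Type*} [TopologicalSpace S] [CompactSpace S]
    [TopologicalSpace Z] [T2Space Z] [MeasurableSpace Z] [BorelSpace Z]
    {π : S → Z} (hπ : Continuous π) (hsurj : Function.Surjective π)
    {f : S → ℝ} (hf : Continuous f) :
    ∃ m : Z → S, (∀ z, π (m z) = z) ∧ Measurable fun z => f (m z) := by
  have hmax : ∀ z, ∃ x, π x = z ∧ ∀ y, π y = z → f y ≤ f x := by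
    intro z
    have hK : IsCompact (π ⁻¹' {z}) := (isClosed_singleton.preimage hπ).isCompact
    obtain ⟨x, hx, hxmax⟩ := hK.exists_isMaxOn (hsurj z) hf.continuousOn
    exact ⟨x, hx, fun y hy => hxmax hy⟩
  choose m hm hmle using hmax
  refine ⟨m, hm, measurable_of_Ici fun c => ?_⟩
  have himage : (fun z => f (m z)) ⁻¹' Set.Ici c = π '' (f ⁻¹' Set.Ici c) := by
    ext z
    constructor
    · exact fun hz => ⟨m z, hz, hm z⟩
    · rintro ⟨x, hx, rfl⟩
      exact le_trans (Set.mem_Ici.1 hx) (hmle _ x rfl)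
  rw [himage]
  exact ((isClosed_Ici.preimage hf).isCompact.image hπ).isClosed.measurableSet

/-- A map semiconjugate to `g` which contracts fibers by `θ` has iterates contracting fibers
by `θ ^ n`. -/
theorem dist_iterate_le_of_fiber_contraction {S Z : Type*} [PseudoMetricSpace S]
    {P : S → S} {π : S → Z} {g : Z → Z} (hcomm : Function.Semiconj π P g)
    {θ : ℝ} (hθ : 0 ≤ θ)
    (hcontr : ∀ x y : S, π x = π y → dist (P x) (P y) ≤ θ * dist x y)
    (n : ℕ) {x y : S} (hxy : π x = π y) :
    dist (P^[n] x) (P^[n] y) ≤ θ ^ n * dist x y := by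
  induction n with
  | zero => simp
  | succ n ih =>
    rw [Function.iterate_succ_apply', Function.iterate_succ_apply']
    have hπ : π (P^[n] x) = π (P^[n] y) := by
      rw [hcomm.iterate_right n x, hcomm.iterate_right n y, hxy]
    calc dist (P (P^[n] x)) (P (P^[n] y)) ≤ θ * dist (P^[n] x) (P^[n] y) := hcontr _ _ hπ
      _ ≤ θ * (θ ^ n * dist x y) := by gcongr
      _ = θ ^ (n + 1) * dist x y := by ring

/-- If a continuous `f` oscillates by at most `ε` on each fiber, and the projection of `ν` is
invariant under the quotient dynamics, then all the integrals `∫ f ∘ P^k dν` are `ε`-close to a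
common constant. -/
theorem exists_forall_abs_integral_iterate_sub_le {S Z : Type*}
    [TopologicalSpace S] [CompactSpace S] [MeasurableSpace S] [BorelSpace S]
    [TopologicalSpace Z] [T2Space Z] [MeasurableSpace Z] [BorelSpace Z]
    {P : S → S} (hP : Continuous P) {π : S → Z} (hπ : Continuous π)
    (hsurj : Function.Surjective π) {g : Z → Z} (hg : Measurable g)
    (hcomm : Function.Semiconj π P g) {ν : Measure S} [IsProbabilityMeasure ν]
    (hinv : Measure.map g (Measure.map π ν) = Measure.map π ν)
    {f : S → ℝ} (hf : Continuous f) {ε : ℝ} (hosc : ∀ x y, π x = π y → |f x - f y| ≤ ε) :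
    ∃ c : ℝ, ∀ k : ℕ, |∫ x, f (P^[k] x) ∂ν - c| ≤ ε := by
  obtain ⟨m, hm, hmeas⟩ := exists_rightInverse_measurable_comp hπ hsurj hf
  have hmp : MeasurePreserving g (Measure.map π ν) (Measure.map π ν) := ⟨hg, hinv⟩
  refine ⟨∫ z, f (m z) ∂(Measure.map π ν), fun k => ?_⟩
  have hcont : Continuous fun x => f (P^[k] x) := hf.comp (hP.iterate k)
  have hcomp : Measurable fun x => f (m (π (P^[k] x))) :=
    hmeas.comp (hπ.comp (hP.iterate k)).measurable
  obtain ⟨C, hC⟩ := (isCompact_range hf).isBounded.exists_norm_le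
  have hint (h : S → S) (hh : Measurable fun x => f (h x)) : Integrable (fun x => f (h x)) ν :=
    Integrable.of_bound hh.aestronglyMeasurable C
      (Eventually.of_forall fun x => hC _ (Set.mem_range_self _))
  have hc : ∫ x, f (m (π (P^[k] x))) ∂ν = ∫ z, f (m z) ∂(Measure.map π ν) := by
    calc ∫ x, f (m (π (P^[k] x))) ∂ν = ∫ x, f (m (g^[k] (π x))) ∂ν := by
          simp only [(hcomm.iterate_right k).eq]
      _ = ∫ z, f (m (g^[k] z)) ∂(Measure.map π ν) :=
          (integral_map hπ.measurable.aemeasurable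
            (hmeas.comp (hg.iterate k)).aestronglyMeasurable).symm
      _ = ∫ z, f (m z) ∂(Measure.map g^[k] (Measure.map π ν)) :=
          (integral_map (hg.iterate k).aemeasurable hmeas.aestronglyMeasurable).symm
      _ = ∫ z, f (m z) ∂(Measure.map π ν) := by rw [(hmp.iterate k).map_eq]
  rw [← hc, ← integral_sub (hint _ hcont.measurable) (hint _ hcomp)]
  have hbound := norm_integral_le_of_norm_le_const (μ := ν)
    (f := fun x => f (P^[k] x) - f (m (π (P^[k] x)))) (C := ε)
    (Eventually.of_forall fun x => hosc _ _ (hm _).symm)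
  simpa using hbound

/-- If all continuous observables have Cauchy integrals along a sequence of probability measures
on a compact metric space, the sequence converges weakly to a probability measure. -/
theorem exists_isProbabilityMeasure_tendsto_integral_of_cauchySeq {S : Type*}
    [MetricSpace S] [CompactSpace S] [MeasurableSpace S] [BorelSpace S]
    (μs : ℕ → ProbabilityMeasure S)
    (hμs : ∀ φ : C(S, ℝ), CauchySeq fun n => ∫ x, φ x ∂(μs n : Measure S)) :
    ∃ μ : Measure S, IsProbabilityMeasure μ ∧ ∀ φ : C(S, ℝ),
      Tendsto (fun n => ∫ x, φ x ∂(μs n : Measure S)) atTop (𝓝 (∫ x, φ x ∂μ)) := by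
  obtain ⟨μ, hμ⟩ := exists_clusterPt_of_compactSpace (map μs atTop)
  refine ⟨μ, inferInstance, fun φ => le_nhds_of_cauchy_adhp (hμs φ) ?_⟩
  have hφ := ProbabilityMeasure.continuous_integral_boundedContinuousFunction
    (BoundedContinuousFunction.mkOfCompact φ)
  exact MapClusterPt.continuousAt_comp (u := μs) hφ.continuousAt hμ

/-- Let `P : S → S` be a continuous skew product over `g : Z → Z` (i.e. `π ∘ P = g ∘ π`)
which contracts the fibers of `π` uniformly by a factor `θ < 1`, on compact metric spaces.
If `ν` is a Borel probability measure on `S` whose projection `π_*ν` is `g`-invariant,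
then for every continuous `φ : S → ℝ` the sequence `n ↦ ∫ φ ∘ P^n dν` is Cauchy;
consequently the pushforwards `P^n_*ν` converge in the weak* topology to a Borel
probability measure on `S`. -/
theorem pushforward_weak_star_cauchy_and_convergent
    {S Z : Type*} [MetricSpace S] [CompactSpace S] [MeasurableSpace S] [BorelSpace S]
    [MetricSpace Z] [CompactSpace Z] [MeasurableSpace Z] [BorelSpace Z]
    (P : S → S) (hPcont : Continuous P)
    (π : S → Z) (hπcont : Continuous π) (hπsurj : Function.Surjective π)
    (g : Z → Z) (hg : Measurable g)
    (hcomm : π ∘ P = g ∘ π)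
    (θ : ℝ) (hθ0 : 0 < θ) (hθ1 : θ < 1)
    (hcontr : ∀ x y : S, π x = π y → dist (P x) (P y) ≤ θ * dist x y)
    (ν : Measure S) [IsProbabilityMeasure ν]
    (hinv : Measure.map g (Measure.map π ν) = Measure.map π ν) :
    (∀ φ : C(S, ℝ), CauchySeq (fun n : ℕ => ∫ x, φ (P^[n] x) ∂ν)) ∧
      ∃ μ : Measure S, IsProbabilityMeasure μ ∧
        ∀ φ : C(S, ℝ),
          Tendsto (fun n : ℕ => ∫ x, φ (P^[n] x) ∂ν) atTop (𝓝 (∫ x, φ x ∂μ)) := by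
  have hsemi : Function.Semiconj π P g := congrFun hcomm
  have hcauchy (φ : C(S, ℝ)) : CauchySeq fun n : ℕ => ∫ x, φ (P^[n] x) ∂ν := by
    refine Metric.cauchySeq_iff'.2 fun ε hε => ?_
    obtain ⟨δ, hδ, hφ⟩ := Metric.uniformContinuous_iff.1
      (CompactSpace.uniformContinuous_of_continuous φ.continuous) (ε / 3) (by positivity)
    have hdiam : Tendsto (fun n : ℕ => θ ^ n * Metric.diam (Set.univ : Set S)) atTop (𝓝 0) := by
      simpa using (tendsto_pow_atTop_nhds_zero_of_lt_one hθ0.le hθ1).mul_const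
        (Metric.diam (Set.univ : Set S))
    obtain ⟨N, hN⟩ := (hdiam.eventually_lt_const hδ).exists
    have hosc (x y : S) (hxy : π x = π y) : |φ (P^[N] x) - φ (P^[N] y)| ≤ ε / 3 := by
      refine (hφ (lt_of_le_of_lt ?_ hN)).le
      refine (dist_iterate_le_of_fiber_contraction hsemi hθ0.le hcontr N hxy).trans ?_
      gcongr
      exact Metric.dist_le_diam_of_mem isCompact_univ.isBounded (Set.mem_univ x) (Set.mem_univ y)
    obtain ⟨c, hc⟩ := exists_forall_abs_integral_iterate_sub_le hPcont hπcont hπsurj hg hsemi hinv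
      (f := fun x => φ (P^[N] x)) (φ.continuous.comp (hPcont.iterate N)) hosc
    refine ⟨N, fun n hn => ?_⟩
    obtain ⟨k, rfl⟩ := Nat.exists_eq_add_of_le hn
    have hk := abs_le.1 (hc k)
    have h0 := abs_le.1 (hc 0)
    simp only [← Function.iterate_add_apply, add_zero] at hk h0
    rw [Real.dist_eq, abs_lt]
    constructor <;> linarith [hk.1, hk.2, h0.1, h0.2]
  have hmeas (n : ℕ) : AEMeasurable P^[n] ν := (hPcont.iterate n).measurable.aemeasurable
  have hmap (φ : C(S, ℝ)) (n : ℕ) :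
      ∫ x, φ x ∂(Measure.map P^[n] ν) = ∫ x, φ (P^[n] x) ∂ν :=
    integral_map (hmeas n) φ.continuous.aestronglyMeasurable
  have hlim := exists_isProbabilityMeasure_tendsto_integral_of_cauchySeq
    fun n => ⟨Measure.map P^[n] ν, Measure.isProbabilityMeasure_map (hmeas n)⟩
  simp only [ProbabilityMeasure.coe_mk, hmap] at hlim
  exact ⟨hcauchy, hlim hcauchy⟩
end

section
/- Let S be a compact metric space, P : S → S a continuous map, Z a compact metric space, π : S → Z a continuous surjection, and g : Z → Z a measurable map with π ∘ P = g ∘ π. Suppose there is θ ∈ (0,1) such that d(P(x), P(y)) ≤ θ · d(x, y) whenever π(x) = π(y). Let ν be a Borel probability measure on S with π_*ν g-invariant, and let μ_P be the weak* limit of the sequence (P^n_*ν)_{n≥1}. Then: (i) μ_P is P-invariant, i.e. P_*μ_P = μ_P; and (ii) μ_P depends only on π_*ν: if ν' is any other Borel probability measure on S with π_*ν' = π_*ν, then P^n_*ν' converges weak* to the same limit μ_P. -/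
open MeasureTheory Filter Topology

/-- The fiberwise maximum of a continuous function along a continuous surjection from a compact
space is measurable. -/
theorem exists_measurable_fiberwise_max {S Z : Type*} [TopologicalSpace S] [CompactSpace S]
    [TopologicalSpace Z] [T2Space Z] [MeasurableSpace Z] [BorelSpace Z]
    {π : S → Z} (hπ : Continuous π) (hsurj : Function.Surjective π)
    {h : S → ℝ} (hh : Continuous h) :
    ∃ u : Z → ℝ, Measurable u ∧ (∀ x, h x ≤ u (π x)) ∧ ∀ z, ∃ x, π x = z ∧ h x = u z := by
  have hmax : ∀ z, ∃ x ∈ π ⁻¹' {z}, IsMaxOn h (π ⁻¹' {z}) x := fun z =>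
    (isClosed_singleton.preimage hπ).isCompact.exists_isMaxOn (hsurj z) hh.continuousOn
  choose m hm hmle using hmax
  refine ⟨fun z => h (m z), measurable_of_Ici fun c => ?_,
    fun x => hmle (π x) rfl, fun z => ⟨m z, hm z, rfl⟩⟩
  have himage : (fun z => h (m z)) ⁻¹' Set.Ici c = π '' (h ⁻¹' Set.Ici c) := by
    ext z
    constructor
    · exact fun hz => ⟨m z, hz, hm z⟩
    · rintro ⟨x, hx, rfl⟩
      have hle : h x ≤ h (m (π x)) := hmle (π x) rfl
      exact hx.trans hle
  rw [himage]
  exact ((isClosed_Ici.preimage hh).isCompact.image hπ).isClosed.measurableSet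

/-- Two probability measures with the same projection assign integrals differing by at most `ε`
to a continuous function whose oscillation on every fiber is at most `ε`. -/
theorem integral_le_integral_add_of_map_eq {S Z : Type*} [TopologicalSpace S] [CompactSpace S] [T2Space S]
    [MeasurableSpace S] [BorelSpace S]
    [TopologicalSpace Z] [T2Space Z] [MeasurableSpace Z] [BorelSpace Z]
    {π : S → Z} (hπ : Continuous π) (hsurj : Function.Surjective π)
    {h : S → ℝ} (hh : Continuous h) {ε : ℝ} (hε : ∀ x y, π x = π y → h x ≤ h y + ε)
    (μ ν : Measure S) [IsProbabilityMeasure μ] [IsProbabilityMeasure ν]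
    (hmap : Measure.map π μ = Measure.map π ν) :
    ∫ x, h x ∂μ ≤ ∫ x, h x ∂ν + ε := by
  obtain ⟨u, hu, hle, hatt⟩ := exists_measurable_fiberwise_max hπ hsurj hh
  have hint : ∀ ρ : Measure S, IsProbabilityMeasure ρ → Integrable h ρ := fun ρ _ =>
    integrableOn_univ.mp (hh.continuousOn.integrableOn_compact isCompact_univ)
  have huε : ∀ x, u (π x) ≤ h x + ε := fun x => by
    obtain ⟨y, hy, hyu⟩ := hatt (π x)
    exact hyu ▸ hε y x hy
  have huint : ∀ ρ : Measure S, IsProbabilityMeasure ρ → Integrable (fun x => u (π x)) ρ :=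
    fun ρ hρ => integrable_of_le_of_le (hu.comp hπ.measurable).aestronglyMeasurable
      (ae_of_all _ hle) (ae_of_all _ huε) (hint ρ hρ) ((hint ρ hρ).add (integrable_const ε))
  calc ∫ x, h x ∂μ ≤ ∫ x, u (π x) ∂μ := integral_mono (hint μ ‹_›) (huint μ ‹_›) hle
    _ = ∫ x, u (π x) ∂ν := by
      rw [← integral_map hπ.aemeasurable hu.aestronglyMeasurable, hmap,
        integral_map hπ.aemeasurable hu.aestronglyMeasurable]
    _ ≤ ∫ x, (h x + ε) ∂ν :=
      integral_mono (huint ν ‹_›) ((hint ν ‹_›).add (integrable_const ε)) huε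
    _ = ∫ x, h x ∂ν + ε := by
      rw [integral_add (hint ν ‹_›) (integrable_const ε)]
      simp

/-- Let `P : S → S` be a continuous skew product over `g : Z → Z` (i.e. `π ∘ P = g ∘ π`)
contracting the fibers of `π` uniformly by `θ < 1`, on compact metric spaces, and let
`ν` be a Borel probability measure on `S` with `π_*ν` `g`-invariant.  If `μ_P` is the
weak* limit of the pushforwards `P^n_*ν`, then (i) `μ_P` is `P`-invariant, and
(ii) `μ_P` depends only on `π_*ν`: for any probability `ν'` with `π_*ν' = π_*ν` the
pushforwards `P^n_*ν'` converge weak* to the same limit `μ_P`. -/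
theorem weak_star_limit_invariant_and_unique
    {S Z : Type*} [MetricSpace S] [CompactSpace S] [MeasurableSpace S] [BorelSpace S]
    [MetricSpace Z] [CompactSpace Z] [MeasurableSpace Z] [BorelSpace Z]
    (P : S → S) (hPcont : Continuous P)
    (π : S → Z) (hπcont : Continuous π) (hπsurj : Function.Surjective π)
    (g : Z → Z) (hg : Measurable g)
    (hcomm : π ∘ P = g ∘ π)
    (θ : ℝ) (hθ0 : 0 < θ) (hθ1 : θ < 1)
    (hcontr : ∀ x y : S, π x = π y → dist (P x) (P y) ≤ θ * dist x y)
    (ν : Measure S) [IsProbabilityMeasure ν]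
    (hinv : Measure.map g (Measure.map π ν) = Measure.map π ν)
    (μP : Measure S) [IsProbabilityMeasure μP]
    (hlim : ∀ φ : C(S, ℝ),
      Tendsto (fun n : ℕ => ∫ x, φ (P^[n] x) ∂ν) atTop (𝓝 (∫ x, φ x ∂μP))) :
    Measure.map P μP = μP ∧
      ∀ ν' : Measure S, IsProbabilityMeasure ν' → Measure.map π ν' = Measure.map π ν →
        ∀ φ : C(S, ℝ),
          Tendsto (fun n : ℕ => ∫ x, φ (P^[n] x) ∂ν') atTop (𝓝 (∫ x, φ x ∂μP)) := by
  have hsemi : Function.Semiconj π P g := fun x => congrFun hcomm x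
  constructor
  · have : IsProbabilityMeasure (Measure.map P μP) :=
      Measure.isProbabilityMeasure_map hPcont.aemeasurable
    refine ext_of_forall_integral_eq_of_IsFiniteMeasure fun f => ?_
    rw [integral_map hPcont.aemeasurable f.continuous.aestronglyMeasurable]
    have hcomp := hlim (f.toContinuousMap.comp ⟨P, hPcont⟩)
    have hshift := (tendsto_add_atTop_iff_nat 1).2 (hlim f.toContinuousMap)
    simp only [Function.iterate_succ_apply'] at hshift
    exact tendsto_nhds_unique hcomp hshift
  · intro ν' _ hmap φ
    refine (hlim φ).congr_dist (Metric.tendsto_atTop.2 fun ε hε => ?_)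
    obtain ⟨δ, hδ, hφ⟩ := Metric.uniformContinuous_iff.1
      (CompactSpace.uniformContinuous_of_continuous φ.continuous) (ε / 2) (half_pos hε)
    have hzero : Tendsto (fun n : ℕ => θ ^ n * Metric.diam (Set.univ : Set S)) atTop (𝓝 0) := by
      simpa using (tendsto_pow_atTop_nhds_zero_of_lt_one hθ0.le hθ1).mul_const
        (Metric.diam (Set.univ : Set S))
    obtain ⟨N, hN⟩ := eventually_atTop.1 (hzero.eventually_lt_const hδ)
    refine ⟨N, fun n hn => ?_⟩
    have hosc : ∀ x y, π x = π y → φ (P^[n] x) ≤ φ (P^[n] y) + ε / 2 := fun x y hxy => by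
      have hdist : dist (P^[n] x) (P^[n] y) < δ :=
        ((dist_iterate_le_of_fiber_contraction hsemi hθ0.le hcontr n hxy).trans
          (mul_le_mul_of_nonneg_left
            (Metric.dist_le_diam_of_mem isCompact_univ.isBounded (Set.mem_univ x)
              (Set.mem_univ y)) (pow_nonneg hθ0.le n))).trans_lt (hN n hn)
      have := (abs_lt.1 (Real.dist_eq _ _ ▸ hφ hdist)).2
      linarith
    have hcont : Continuous fun x => φ (P^[n] x) := φ.continuous.comp (hPcont.iterate n)
    have h₁ := integral_le_integral_add_of_map_eq hπcont hπsurj hcont hosc ν ν' hmap.symm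
    have h₂ := integral_le_integral_add_of_map_eq hπcont hπsurj hcont hosc ν' ν hmap
    rw [Real.dist_0_eq_abs, abs_of_nonneg dist_nonneg, Real.dist_eq, abs_lt]
    constructor <;> linarith
end

section
/- Let 0 = a₀ < a₁ < ⋯ < a_k = 1 be a finite partition of [0,1] and let g : [0,1] → [0,1] be a map such that for each i ∈ {1, …, k} the restriction of g to the open interval (a_{i−1}, a_i) extends to a C² function on the closed interval [a_{i−1}, a_i], and such that there is λ > 1 with |g'(x)| ≥ λ for all x in each (a_{i−1}, a_i). Then there exists a g-invariant Borel probability measure on [0,1] which is absolutely continuous with respect to Lebesgue measure. -/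
open MeasureTheory

namespace LasotaYorke

open Filter Set Topology ENNReal

/-- A setwise limit of probability measures along an ultrafilter is again a probability measure
if the measures are uniformly dominated by a multiple of a finite measure. -/
theorem exists_measure_tendsto_of_le_smul {α ι : Type*} [MeasurableSpace α] (m : Measure α)
    [IsFiniteMeasure m] (c : ℝ≥0∞) (hc : c ≠ ∞) (u : Ultrafilter ι) (ν : ι → Measure α)
    (hν : ∀ i, ν i ≤ c • m) :
    ∃ μ : Measure α, μ ≤ c • m ∧
      ∀ A, MeasurableSet A → Tendsto (fun i => ν i A) u (𝓝 (μ A)) := by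
  let L : Set α → ℝ≥0∞ := fun A => (u.map fun i => ν i A).lim
  have hL : ∀ A, Tendsto (fun i => ν i A) u (𝓝 (L A)) := fun A =>
    (u.map fun i => ν i A).le_nhds_lim
  have hLc : ∀ A, L A ≤ c * m A := fun A =>
    le_of_tendsto' (hL A) fun i => hν i A
  have hL0 : L ∅ = 0 := by simpa using hLc ∅
  have hmono : ∀ A B, A ⊆ B → L A ≤ L B := fun A B h =>
    le_of_tendsto_of_tendsto' (hL A) (hL B) fun i => measure_mono h
  have hadd : ∀ A B, MeasurableSet B → Disjoint A B → L (A ∪ B) = L A + L B := by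
    intro A B hB h
    refine tendsto_nhds_unique (hL _) ?_
    simpa only [measure_union h hB] using (hL A).add (hL B)
  have hU : ∀ ⦃A : ℕ → Set α⦄, (∀ i, MeasurableSet (A i)) →
      Pairwise (Function.onFun Disjoint A) → L (⋃ i, A i) = ∑' i, L (A i) := by
    intro A hA hd
    have hsplit : ∀ n, L (⋃ i, A i) = ∑ i ∈ Finset.range n, L (A i) + L (⋃ i, A (i + n)) := by
      intro n
      induction n with
      | zero => simp
      | succ n ih =>
        have h1 : (⋃ i, A (i + n)) = A n ∪ ⋃ i, A (i + (n + 1)) := by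
          rw [← union_iUnion_nat_succ (u := fun i => A (i + n))]
          simp only [zero_add, add_assoc, add_comm 1 n]
        have h2 : Disjoint (A n) (⋃ i, A (i + (n + 1))) := by
          rw [disjoint_iUnion_right]
          exact fun i => hd (by omega)
        rw [ih, h1, hadd _ _ (MeasurableSet.iUnion fun i => hA _) h2, Finset.sum_range_succ,
          add_assoc]
    refine le_antisymm ?_ ?_
    · have hfin : ∑' i, m (A i) ≠ ∞ := by
        rw [← measure_iUnion hd hA]
        exact measure_ne_top _ _
      have ht : Tendsto (fun n => ∑' i, L (A i) + c * ∑' i, m (A (i + n))) atTop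
          (𝓝 (∑' i, L (A i) + c * 0)) :=
        tendsto_const_nhds.add
          (ENNReal.Tendsto.const_mul (ENNReal.tendsto_sum_nat_add _ hfin) (Or.inr hc))
      rw [mul_zero, add_zero] at ht
      refine ge_of_tendsto' ht fun n => ?_
      rw [hsplit n]
      refine add_le_add (ENNReal.sum_le_tsum _) ((hLc _).trans ?_)
      gcongr
      exact measure_iUnion_le _
    · rw [ENNReal.tsum_eq_iSup_nat]
      exact iSup_le fun n => by rw [hsplit n]; exact le_self_add
  let μ : Measure α := Measure.ofMeasurable (fun A _ => L A) hL0 hU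
  have hμ : ∀ A, MeasurableSet A → μ A = L A := fun A hA => Measure.ofMeasurable_apply A hA
  refine ⟨μ, Measure.le_iff.2 fun A hA => ?_, fun A hA => ?_⟩
  · rw [hμ A hA]; exact hLc A
  · rw [hμ A hA]; exact hL A

/-- A map all of whose iterates push a probability measure `m` to measures dominated by a fixed
multiple of `m` has an invariant probability measure which is absolutely continuous with respect
to `m`. -/
theorem exists_invariant_of_iterate_map_le_smul {α : Type*} [MeasurableSpace α] (m : Measure α)
    [IsProbabilityMeasure m] {f : α → α} (hf : Measurable f) (c : ℝ≥0∞) (hc : c ≠ ∞)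
    (h : ∀ n, m.map f^[n] ≤ c • m) :
    ∃ μ : Measure α, IsProbabilityMeasure μ ∧ μ.map f = μ ∧ μ ≪ m := by
  let ν : ℕ → Measure α := fun n =>
    (n + 1 : ℝ≥0∞)⁻¹ • ∑ j ∈ Finset.range (n + 1), m.map f^[j]
  have hcancel : ∀ n : ℕ, (n + 1 : ℝ≥0∞)⁻¹ * (n + 1) = 1 := fun n =>
    ENNReal.inv_mul_cancel (by simp) (by finiteness)
  have hνapp : ∀ n A, ν n A = (n + 1 : ℝ≥0∞)⁻¹ * ∑ j ∈ Finset.range (n + 1), m.map f^[j] A := by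
    intro n A
    simp [ν]
  have hprob : ∀ j, IsProbabilityMeasure (m.map f^[j]) := fun j =>
    Measure.isProbabilityMeasure_map (hf.iterate j).aemeasurable
  have hνle : ∀ n, ν n ≤ c • m := by
    intro n
    refine Measure.le_iff.2 fun A hA => ?_
    rw [hνapp]
    calc _ ≤ (n + 1 : ℝ≥0∞)⁻¹ * ∑ j ∈ Finset.range (n + 1), (c • m) A := by
          gcongr with j _
          exact h j
      _ = (c • m) A := by
          rw [Finset.sum_const, Finset.card_range, nsmul_eq_mul, ← mul_assoc]
          push_cast
          rw [hcancel, one_mul]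
  obtain ⟨μ, hμc, hμ⟩ := exists_measure_tendsto_of_le_smul m c hc (hyperfilter ℕ) ν hνle
  have hinv0 : Tendsto (fun n : ℕ => (n + 1 : ℝ≥0∞)⁻¹) (hyperfilter ℕ : Filter ℕ) (𝓝 0) := by
    have : Tendsto (fun n : ℕ => ((n + 1 : ℕ) : ℝ≥0∞)⁻¹) atTop (𝓝 0) :=
      ENNReal.tendsto_inv_nat_nhds_zero.comp (tendsto_add_atTop_nat 1)
    push_cast at this
    exact this.mono_left Nat.hyperfilter_le_atTop
  have hpre : ∀ j A, MeasurableSet A → m.map f^[j] (f ⁻¹' A) = m.map f^[j + 1] A := by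
    intro j A hA
    rw [Measure.map_apply (hf.iterate j) (hf hA), Measure.map_apply (hf.iterate _) hA,
      Function.iterate_succ', preimage_comp]
  have hkey : ∀ n A, MeasurableSet A →
      ν n (f ⁻¹' A) + (n + 1 : ℝ≥0∞)⁻¹ * m A =
        ν n A + (n + 1 : ℝ≥0∞)⁻¹ * m.map f^[n + 1] A := by
    intro n A hA
    rw [hνapp, hνapp, ← mul_add, ← mul_add, ← Finset.sum_range_succ,
      Finset.sum_range_succ' _ (n + 1)]
    simp only [hpre _ A hA, Function.iterate_zero, Measure.map_id]
  have herr : ∀ p : ℕ → ℝ≥0∞, (∀ n, p n ≤ 1) →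
      Tendsto (fun n : ℕ => (n + 1 : ℝ≥0∞)⁻¹ * p n) (hyperfilter ℕ : Filter ℕ) (𝓝 0) := by
    intro p hp
    refine tendsto_of_tendsto_of_tendsto_of_le_of_le tendsto_const_nhds hinv0
      (fun _ => zero_le) fun n => ?_
    exact mul_le_of_le_one_right (zero_le) (hp n)
  refine ⟨μ, ⟨?_⟩, ?_, ?_⟩
  · refine tendsto_nhds_unique (hμ univ MeasurableSet.univ) ?_
    have : ∀ n, ν n univ = 1 := by
      intro n
      rw [hνapp]
      simp only [measure_univ, Finset.sum_const, Finset.card_range, nsmul_eq_mul, mul_one]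
      push_cast
      exact hcancel n
    simp only [this]
    exact tendsto_const_nhds
  · ext A hA
    rw [Measure.map_apply hf hA]
    have h1 := (hμ _ (hf hA)).add (herr (fun _ => m A) fun _ => prob_le_one)
    have h2 := (hμ _ hA).add (herr (fun n => m.map f^[n + 1] A) fun n => prob_le_one)
    simp only [hkey _ A hA] at h1
    simpa using tendsto_nhds_unique h1 h2
  · exact (Measure.absolutelyContinuous_of_le hμc).trans
      (Measure.smul_absolutelyContinuous)

/-- The measure `ν` has density of variation at most `V` on `[0, 1]`, in weak form: the integral of
a bounded test function is controlled by the supremum of its primitive. -/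
def HasVariationBound (V : ℝ) (ν : Measure ℝ) : Prop :=
  ∀ φ : ℝ → ℝ, Measurable φ → (∃ b, ∀ x, |φ x| ≤ b) →
    ∀ M, (∀ x ∈ Icc (0 : ℝ) 1, |∫ t in 0..x, φ t| ≤ M) → |∫ x, φ x ∂ν| ≤ V * M

theorem integrable_of_measurable_of_abs_le {α : Type*} [MeasurableSpace α] {μ : Measure α}
    [IsFiniteMeasure μ] {φ : α → ℝ} (hφ : Measurable φ) {b : ℝ} (hb : ∀ x, |φ x| ≤ b) :
    Integrable φ μ :=
  Integrable.of_bound hφ.aestronglyMeasurable b (ae_of_all _ hb)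

theorem intervalIntegrable_of_measurable_of_abs_le {φ : ℝ → ℝ} (hφ : Measurable φ) {b : ℝ}
    (hb : ∀ x, |φ x| ≤ b) (x y : ℝ) : IntervalIntegrable φ volume x y :=
  ⟨integrable_of_measurable_of_abs_le hφ hb, integrable_of_measurable_of_abs_le hφ hb⟩

theorem nonneg_of_abs_integral_le {φ : ℝ → ℝ} {M : ℝ}
    (hM : ∀ x ∈ Icc (0 : ℝ) 1, |∫ t in 0..x, φ t| ≤ M) : 0 ≤ M :=
  (abs_nonneg _).trans (hM 0 (by simp))

theorem HasVariationBound.mono {V W : ℝ} {ν : Measure ℝ} (h : HasVariationBound V ν)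
    (hVW : V ≤ W) : HasVariationBound W ν := fun φ hφ hb M hM =>
  (h φ hφ hb M hM).trans (mul_le_mul_of_nonneg_right hVW (nonneg_of_abs_integral_le hM))

theorem hasVariationBound_volume_restrict :
    HasVariationBound 1 (volume.restrict (Icc (0 : ℝ) 1)) := by
  intro φ _ _ M hM
  rw [one_mul, integral_Icc_eq_integral_Ioc, ← intervalIntegral.integral_of_le zero_le_one]
  exact hM 1 (by simp)

theorem HasVariationBound.le_smul {V : ℝ} {ν : Measure ℝ} [IsFiniteMeasure ν]
    (h : HasVariationBound V ν) :
    ν ≤ ENNReal.ofReal V • volume.restrict (Icc (0 : ℝ) 1) := by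
  refine Measure.le_iff.2 fun A hA => ?_
  have hb : ∀ x, |A.indicator (fun _ => (1 : ℝ)) x| ≤ 1 := by
    intro x
    by_cases hx : x ∈ A <;> simp [hx]
  have key := h (A.indicator fun _ => 1) (measurable_const.indicator hA) ⟨1, hb⟩
    ((volume.restrict (Icc (0 : ℝ) 1)).real A) ?_
  · rw [integral_indicator_const _ hA, smul_eq_mul, mul_one, abs_of_nonneg measureReal_nonneg]
      at key
    have h0 : 0 ≤ V * (volume.restrict (Icc (0 : ℝ) 1)).real A := measureReal_nonneg.trans key
    rw [Measure.smul_apply, smul_eq_mul, ← ofReal_measureReal (μ := ν)]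
    rcases le_or_gt 0 V with hV | hV
    · rw [← ofReal_measureReal (μ := volume.restrict (Icc (0 : ℝ) 1)), ← ENNReal.ofReal_mul hV]
      exact ENNReal.ofReal_le_ofReal key
    · have : ν.real A ≤ 0 :=
        key.trans (mul_nonpos_of_nonpos_of_nonneg hV.le measureReal_nonneg)
      rw [ENNReal.ofReal_of_nonpos this]
      exact zero_le
  · intro x hx
    rw [intervalIntegral.integral_of_le hx.1, integral_indicator_const _ hA, smul_eq_mul, mul_one,
      abs_of_nonneg measureReal_nonneg]
    refine ENNReal.toReal_mono (measure_ne_top _ _) ?_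
    exact Measure.restrict_mono (Ioc_subset_Icc_self.trans (Icc_subset_Icc_right hx.2)) le_rfl A

/-- It suffices to test the variation bound on bounded continuous functions. -/
theorem hasVariationBound_of_continuous {V : ℝ} (hV : 0 ≤ V) {ν : Measure ℝ} [IsFiniteMeasure ν]
    (h : ∀ φ : ℝ → ℝ, Continuous φ → (∃ b, ∀ x, |φ x| ≤ b) →
      ∀ M, (∀ x ∈ Icc (0 : ℝ) 1, |∫ t in 0..x, φ t| ≤ M) → |∫ x, φ x ∂ν| ≤ V * M) :
    HasVariationBound V ν := by
  rintro φ hφ ⟨b, hb⟩ M hM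
  let m : Measure ℝ := volume.restrict (Icc (0 : ℝ) 1)
  refine le_of_forall_pos_le_add fun ε hε => ?_
  have hδ : 0 < ε / (V + 1) := by positivity
  obtain ⟨χ, hχs, hχ, hχc, -⟩ :=
    (integrable_of_measurable_of_abs_le (μ := m + ν) hφ hb).exists_hasCompactSupport_integral_sub_le
      hδ
  obtain ⟨b', hb'⟩ := hχc.bounded_above_of_compact_support hχs
  have hd : ∀ x, ‖φ x - χ x‖ ≤ b + b' := fun x =>
    (norm_sub_le _ _).trans (add_le_add (hb x) (hb' x))
  have hdm : Measurable fun x => ‖φ x - χ x‖ := (hφ.sub hχc.measurable).norm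
  have hdi : ∀ (μ : Measure ℝ) [IsFiniteMeasure μ], Integrable (fun x => ‖φ x - χ x‖) μ :=
    fun μ _ => integrable_of_measurable_of_abs_le hdm (b := b + b') fun x => by
      rw [abs_norm]; exact hd x
  have hφi : ∀ (μ : Measure ℝ) [IsFiniteMeasure μ], Integrable φ μ :=
    fun μ _ => integrable_of_measurable_of_abs_le hφ hb
  have hχi : ∀ (μ : Measure ℝ) [IsFiniteMeasure μ], Integrable χ μ :=
    fun μ _ => integrable_of_measurable_of_abs_le hχc.measurable hb'
  rw [integral_add_measure (hdi m) (hdi ν)] at hχ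
  have hm0 : 0 ≤ ∫ x, ‖φ x - χ x‖ ∂m := integral_nonneg fun _ => norm_nonneg _
  have hν0 : 0 ≤ ∫ x, ‖φ x - χ x‖ ∂ν := integral_nonneg fun _ => norm_nonneg _
  have h1 := h χ hχc ⟨b', hb'⟩ (M + ∫ x, ‖φ x - χ x‖ ∂m) ?_
  · have h2 : |∫ x, φ x ∂ν - ∫ x, χ x ∂ν| ≤ ∫ x, ‖φ x - χ x‖ ∂ν := by
      rw [← integral_sub (hφi ν) (hχi ν), ← Real.norm_eq_abs]
      exact norm_integral_le_integral_norm _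
    have h3 : |∫ x, φ x ∂ν| ≤ |∫ x, φ x ∂ν - ∫ x, χ x ∂ν| + |∫ x, χ x ∂ν| := by
      simpa using abs_add_le (∫ x, φ x ∂ν - ∫ x, χ x ∂ν) (∫ x, χ x ∂ν)
    have h4 : (V + 1) * (∫ x, ‖φ x - χ x‖ ∂m + ∫ x, ‖φ x - χ x‖ ∂ν) ≤ ε := by
      rw [mul_comm]
      exact (le_div_iff₀ (by positivity)).1 hχ
    nlinarith [mul_nonneg hV hν0]
  · intro x hx
    have h2 : |∫ t in 0..x, (χ t - φ t)| ≤ ∫ x, ‖φ x - χ x‖ ∂m := by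
      rw [intervalIntegral.integral_of_le hx.1, ← Real.norm_eq_abs]
      refine (norm_integral_le_integral_norm _).trans ?_
      simp only [norm_sub_rev (χ _)]
      exact setIntegral_mono_set (hdi m) (ae_of_all _ fun _ => norm_nonneg _)
        (Ioc_subset_Icc_self.trans (Icc_subset_Icc_right hx.2)).eventuallyLE
    rw [intervalIntegral.integral_sub
      (intervalIntegrable_of_measurable_of_abs_le hχc.measurable hb' _ _)
      (intervalIntegrable_of_measurable_of_abs_le hφ hb _ _)] at h2
    have h3 := hM x hx
    rw [abs_le] at h2 h3 ⊢
    constructor <;> linarith [h2.1, h2.2, h3.1, h3.2]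

/-- Subtracting a suitable step function, a function whose integrals over the gaps of a finite set
are bounded by `K` is turned into one whose primitive is bounded by `K`. -/
theorem exists_correction (n : ℕ) : ∀ (S : Finset ℝ), S.card ≤ n → ∀ p q : ℝ, p < q →
    ∃ C, 0 ≤ C ∧ ∀ φ : ℝ → ℝ, (∀ x y, IntervalIntegrable φ volume x y) → ∀ K,
      (∀ x y, p ≤ x → x ≤ y → y ≤ q → (∀ s ∈ S, s ∉ Ioo x y) → |∫ t in x..y, φ t| ≤ K) →
      ∃ c : ℝ → ℝ, Measurable c ∧ (∀ x, |c x| ≤ C * K) ∧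
        (∀ x ∈ Icc p q, |∫ t in p..x, (φ t - c t)| ≤ K) ∧ ∫ t in p..q, (φ t - c t) = 0 := by
  induction n with
  | zero =>
    intro S hS p q hpq
    have hq : 0 < q - p := sub_pos.2 hpq
    obtain rfl : S = ∅ := by simpa using hS
    refine ⟨1 / (q - p), by positivity, fun φ hφ K hK => ?_⟩
    set I : ℝ := ∫ t in p..q, φ t with hI
    have hIK : |I| ≤ K := hK p q le_rfl hpq.le le_rfl (by simp)
    have hint : ∀ x, ∫ t in p..x, (φ t - I / (q - p)) =
        (∫ t in p..x, φ t) - (x - p) * (I / (q - p)) := by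
      intro x
      rw [intervalIntegral.integral_sub (hφ _ _) (by simp), intervalIntegral.integral_const,
        smul_eq_mul]
    refine ⟨fun _ => I / (q - p), measurable_const, fun x => ?_, fun x hx => ?_, ?_⟩
    · rw [abs_div, abs_of_pos hq, div_mul_eq_mul_div, one_mul]
      gcongr
    · have h1 : |∫ t in p..x, φ t| ≤ K := hK p x le_rfl hx.1 hx.2 (by simp)
      have h2 : |∫ t in x..q, φ t| ≤ K := hK x q hx.1 hx.2 le_rfl (by simp)
      have h3 : I = (∫ t in p..x, φ t) + ∫ t in x..q, φ t :=
        (intervalIntegral.integral_add_adjacent_intervals (hφ _ _) (hφ _ _)).symm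
      rw [hint]
      set A := ∫ t in p..x, φ t
      set B := ∫ t in x..q, φ t
      have h4 : A - (x - p) * (I / (q - p)) = ((q - x) * A - (x - p) * B) / (q - p) := by
        rw [h3]; field_simp; ring
      rw [h4, abs_div, abs_of_pos hq, div_le_iff₀ hq]
      have hx1 := sub_nonneg.2 hx.1
      have hx2 := sub_nonneg.2 hx.2
      calc |(q - x) * A - (x - p) * B| ≤ |(q - x) * A| + |(x - p) * B| := abs_sub _ _
        _ = (q - x) * |A| + (x - p) * |B| := by
          rw [abs_mul, abs_mul, abs_of_nonneg hx1, abs_of_nonneg hx2]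
        _ ≤ (q - x) * K + (x - p) * K := by gcongr
        _ = K * (q - p) := by ring
    · rw [hint, ← hI]
      field_simp
      ring
  | succ n ih =>
    intro S hS p q hpq
    by_cases hex : ∃ s ∈ S, s ∈ Ioo p q
    · obtain ⟨s, hsS, hps, hsq⟩ := hex
      have hcard : (S.erase s).card ≤ n := by
        rw [Finset.card_erase_of_mem hsS]; omega
      obtain ⟨C₁, hC₁, H₁⟩ := ih (S.erase s) hcard p s hps
      obtain ⟨C₂, hC₂, H₂⟩ := ih (S.erase s) hcard s q hsq
      refine ⟨max C₁ C₂, le_max_of_le_left hC₁, fun φ hφ K hK => ?_⟩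
      have hK0 : 0 ≤ K := (abs_nonneg _).trans (hK p p le_rfl le_rfl hpq.le (by simp))
      obtain ⟨c₁, hc₁m, hc₁, hp₁, hz₁⟩ := H₁ φ hφ K fun x y hx hxy hy hS' => by
        refine hK x y hx hxy (hy.trans hsq.le) fun t ht htxy => ?_
        by_cases hts : t = s
        · exact absurd htxy.2 (by rw [hts]; exact hy.not_gt)
        · exact hS' t (Finset.mem_erase.2 ⟨hts, ht⟩) htxy
      obtain ⟨c₂, hc₂m, hc₂, hp₂, hz₂⟩ := H₂ φ hφ K fun x y hx hxy hy hS' => by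
        refine hK x y (hps.le.trans hx) hxy hy fun t ht htxy => ?_
        by_cases hts : t = s
        · exact absurd htxy.1 (by rw [hts]; exact hx.not_gt)
        · exact hS' t (Finset.mem_erase.2 ⟨hts, ht⟩) htxy
      set c : ℝ → ℝ := fun x => if x ≤ s then c₁ x else c₂ x with hc
      have hcm : Measurable c := Measurable.ite measurableSet_Iic hc₁m hc₂m
      have hcb : ∀ x, |c x| ≤ max C₁ C₂ * K := by
        intro x
        simp only [hc]
        split_ifs
        · exact (hc₁ x).trans (mul_le_mul_of_nonneg_right (le_max_left _ _) hK0)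
        · exact (hc₂ x).trans (mul_le_mul_of_nonneg_right (le_max_right _ _) hK0)
      have hsub : ∀ x y, IntervalIntegrable (fun t => φ t - c t) volume x y := fun x y =>
        (hφ x y).sub (intervalIntegrable_of_measurable_of_abs_le hcm hcb x y)
      have hleft : ∀ x ∈ Icc p s, ∫ t in p..x, (φ t - c t) = ∫ t in p..x, (φ t - c₁ t) := by
        intro x hx
        refine intervalIntegral.integral_congr_ae (ae_of_all _ fun t ht => ?_)
        rw [uIoc_of_le hx.1] at ht
        simp [hc, ht.2.trans hx.2]
      have hright : ∀ x ∈ Icc s q, ∫ t in s..x, (φ t - c t) = ∫ t in s..x, (φ t - c₂ t) := by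
        intro x hx
        refine intervalIntegral.integral_congr_ae (ae_of_all _ fun t ht => ?_)
        rw [uIoc_of_le hx.1] at ht
        simp [hc, ht.1.not_ge]
      have hcross : ∀ x ∈ Icc s q, ∫ t in p..x, (φ t - c t) = ∫ t in s..x, (φ t - c₂ t) := by
        intro x hx
        rw [← intervalIntegral.integral_add_adjacent_intervals (hsub p s) (hsub s x),
          hleft s ⟨hps.le, le_rfl⟩, hz₁, zero_add, hright x hx]
      refine ⟨c, hcm, hcb, fun x hx => ?_, ?_⟩
      · rcases le_total x s with hxs | hxs
        · rw [hleft x ⟨hx.1, hxs⟩]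
          exact hp₁ x ⟨hx.1, hxs⟩
        · rw [hcross x ⟨hxs, hx.2⟩]
          exact hp₂ x ⟨hxs, hx.2⟩
      · rw [hcross q ⟨hsq.le, le_rfl⟩, hz₂]
    · obtain ⟨C, hC, H⟩ := ih ∅ (by simp) p q hpq
      refine ⟨C, hC, fun φ hφ K hK => H φ hφ K fun x y hx hxy hy _ => hK x y hx hxy hy ?_⟩
      exact fun s hs hsxy => hex ⟨s, hs, hx.trans_lt hsxy.1, hsxy.2.trans_le hy⟩

/-- Off the finite set `S`, the map `f` of `[0, 1]` is twice differentiable, expands by at least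
`lam`, has second derivative bounded by `B`, and has finite fibers. -/
structure IsExpandingOff (f : ℝ → ℝ) (S : Finset ℝ) (lam B : ℝ) : Prop where
  measurable : Measurable f
  mem_Icc : ∀ x, f x ∈ Icc (0 : ℝ) 1
  differentiableAt : ∀ x ∈ Icc (0 : ℝ) 1, x ∉ S → DifferentiableAt ℝ f x
  differentiableAt_deriv : ∀ x ∈ Icc (0 : ℝ) 1, x ∉ S → DifferentiableAt ℝ (deriv f) x
  le_abs_deriv : ∀ x ∈ Icc (0 : ℝ) 1, x ∉ S → lam ≤ |deriv f x|
  abs_deriv_deriv_le : ∀ x ∈ Icc (0 : ℝ) 1, x ∉ S → |deriv (deriv f) x| ≤ B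
  finite_fiber : ∀ y, {x | x ∈ Icc (0 : ℝ) 1 ∧ x ∉ S ∧ f x = y}.Finite

namespace IsExpandingOff

variable {f : ℝ → ℝ} {S : Finset ℝ} {lam B : ℝ}

/-- For a test function `φ` with primitive bounded by `M`, the function `φ ∘ f^[N]` is, up to an
error of size `C * M`, the derivative off a finite set of a function bounded by `lam⁻¹ ^ N * M`. -/
theorem exists_primitive (hf : IsExpandingOff f S lam B) (hlam : 1 < lam) (hB : 0 ≤ B) (N : ℕ) :
    ∃ (T : Finset ℝ) (C : ℝ), 0 ≤ C ∧ ∀ φ : ℝ → ℝ, Continuous φ → ∀ M,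
      (∀ x ∈ Icc (0 : ℝ) 1, |∫ t in 0..x, φ t| ≤ M) →
      ∃ Ψ χ : ℝ → ℝ, Measurable Ψ ∧ Measurable χ ∧ ∀ x ∈ Icc (0 : ℝ) 1, x ∉ T →
        HasDerivAt Ψ (χ x) x ∧ |Ψ x| ≤ lam⁻¹ ^ N * M ∧ |χ x - φ (f^[N] x)| ≤ C * M := by
  have hlam0 : 0 < lam := one_pos.trans hlam
  induction N with
  | zero =>
    refine ⟨∅, 0, le_rfl, fun φ hφ M hM => ?_⟩
    refine ⟨fun x => ∫ t in 0..x, φ t, φ, ?_, hφ.measurable, fun x hx _ => ⟨?_, ?_, ?_⟩⟩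
    · exact (intervalIntegral.continuous_primitive
        (fun a b => hφ.intervalIntegrable a b) 0).measurable
    · exact intervalIntegral.integral_hasDerivAt_right (hφ.intervalIntegrable _ _)
        (hφ.stronglyMeasurableAtFilter _ _) hφ.continuousAt
    · simpa using hM x hx
    · simp
  | succ N ih =>
    obtain ⟨T, C, hC, H⟩ := ih
    have hfin : {x | x ∈ Icc (0 : ℝ) 1 ∧ x ∉ S ∧ f x ∈ T}.Finite := by
      refine (T.finite_toSet.biUnion fun y _ => hf.finite_fiber y).subset ?_
      rintro x ⟨hx, hxS, hxT⟩
      exact mem_biUnion (Finset.mem_coe.2 hxT) ⟨hx, hxS, rfl⟩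
    refine ⟨S ∪ hfin.toFinset, C + B, by positivity, fun φ hφ M hM => ?_⟩
    have hM0 := nonneg_of_abs_integral_le hM
    obtain ⟨Ψ, χ, hΨ, hχ, h⟩ := H φ hφ M hM
    have hf' := measurable_deriv f
    have hf'' := measurable_deriv (deriv f)
    refine ⟨fun x => Ψ (f x) / deriv f x,
      fun x => χ (f x) - Ψ (f x) * deriv (deriv f) x / deriv f x ^ 2,
      (hΨ.comp hf.measurable).div hf',
      (hχ.comp hf.measurable).sub (((hΨ.comp hf.measurable).mul hf'').div (hf'.pow_const 2)),
      fun x hx hxT => ?_⟩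
    simp only [Finset.mem_union, Finite.mem_toFinset, mem_ofPred_eq, not_or, not_and] at hxT
    obtain ⟨hxS, hxT⟩ := hxT
    obtain ⟨hd, hb, he⟩ := h (f x) (hf.mem_Icc x) (hxT hx hxS)
    have hle := hf.le_abs_deriv x hx hxS
    have hne : deriv f x ≠ 0 := abs_pos.1 (hlam0.trans_le hle)
    have hpow : lam⁻¹ ^ N ≤ 1 := pow_le_one₀ (by positivity) (inv_le_one_of_one_le₀ hlam.le)
    refine ⟨?_, ?_, ?_⟩
    · refine ((hd.comp x (hf.differentiableAt x hx hxS).hasDerivAt).div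
        (hf.differentiableAt_deriv x hx hxS).hasDerivAt hne).congr_deriv ?_
      simp only [Function.comp_apply]
      field_simp
    · rw [abs_div, div_le_iff₀ (abs_pos.2 hne)]
      calc |Ψ (f x)| ≤ lam⁻¹ ^ N * M := hb
        _ = lam⁻¹ ^ (N + 1) * M * lam := by rw [pow_succ]; field_simp
        _ ≤ lam⁻¹ ^ (N + 1) * M * |deriv f x| := by gcongr
    · have h1 : |Ψ (f x) * deriv (deriv f) x / deriv f x ^ 2| ≤ B * M := by
        rw [abs_div, abs_mul, abs_pow, div_le_iff₀ (by positivity)]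
        calc |Ψ (f x)| * |deriv (deriv f) x| ≤ (lam⁻¹ ^ N * M) * B := by
              gcongr
              exact hf.abs_deriv_deriv_le x hx hxS
          _ ≤ (1 * M) * B := by gcongr
          _ = B * M * 1 := by ring
          _ ≤ B * M * |deriv f x| ^ 2 := by
            gcongr
            exact one_le_pow₀ (hlam.le.trans hle)
      rw [Function.iterate_succ_apply]
      calc _ = |(χ (f x) - φ (f^[N] (f x)))
              - Ψ (f x) * deriv (deriv f) x / deriv f x ^ 2| := by congr 1; ring
        _ ≤ C * M + B * M := (abs_sub _ _).trans (add_le_add he h1)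
        _ = (C + B) * M := by ring

/-- The Lasota–Yorke inequality. -/
theorem exists_hasVariationBound_map (hf : IsExpandingOff f S lam B) (hlam : 1 < lam)
    (hB : 0 ≤ B) (N : ℕ) :
    ∃ C, 0 ≤ C ∧ ∀ (ν : Measure ℝ) [IsProbabilityMeasure ν] (V : ℝ), 0 ≤ V →
      HasVariationBound V ν → HasVariationBound (2 * lam⁻¹ ^ N * V + C) (ν.map f^[N]) := by
  have hlam0 : 0 < lam := one_pos.trans hlam
  obtain ⟨T, C, hC, H⟩ := hf.exists_primitive hlam hB N
  obtain ⟨C', hC', H'⟩ := exists_correction T.card T le_rfl 0 1 zero_lt_one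
  refine ⟨C + C' * (2 * lam⁻¹ ^ N), by positivity, fun ν _ V hV hν => ?_⟩
  have hfN : Measurable f^[N] := hf.measurable.iterate N
  have : IsProbabilityMeasure (ν.map f^[N]) := Measure.isProbabilityMeasure_map hfN.aemeasurable
  refine hasVariationBound_of_continuous (by positivity) ?_
  rintro φ hφ ⟨b, hb⟩ M hM
  have hM0 := nonneg_of_abs_integral_le hM
  obtain ⟨Ψ, χ₀, -, hχ₀, h⟩ := H φ hφ M hM
  set G : Set ℝ := Icc 0 1 \ T with hG
  have hGm : MeasurableSet G := measurableSet_Icc.diff T.measurableSet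
  set χ := G.indicator χ₀ with hχ
  have hχm : Measurable χ := hχ₀.indicator hGm
  have hχG : ∀ x ∈ G, χ x = χ₀ x := fun x hx => indicator_of_mem hx _
  have hb0 : 0 ≤ b := (abs_nonneg _).trans (hb 0)
  have hχb : ∀ x, |χ x| ≤ b + C * M := by
    intro x
    by_cases hx : x ∈ G
    · rw [hχG x hx]
      have h1 := (h x hx.1 hx.2).2.2
      have h2 := hb (f^[N] x)
      rw [abs_le] at h1 h2 ⊢
      constructor <;> linarith [h1.1, h1.2, h2.1, h2.2]
    · rw [hχ, indicator_of_notMem hx, abs_zero]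
      positivity
  have hχi := intervalIntegrable_of_measurable_of_abs_le hχm hχb
  have hgap : ∀ x y, 0 ≤ x → x ≤ y → y ≤ 1 → (∀ s ∈ T, s ∉ Ioo x y) →
      |∫ t in x..y, χ t| ≤ 2 * lam⁻¹ ^ N * M := by
    intro x y hx hxy hy hT
    rcases hxy.eq_or_lt with rfl | hxy
    · rw [intervalIntegral.integral_same, abs_zero]
      positivity
    have hIoo : Ioo x y ⊆ G := fun t ht =>
      ⟨⟨hx.trans ht.1.le, ht.2.le.trans hy⟩, fun htT => hT t htT ht⟩
    have hinner : ∀ u ∈ Ioo x y, ∀ v ∈ Ioo x y, |∫ t in u..v, χ t| ≤ 2 * lam⁻¹ ^ N * M := by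
      intro u hu v hv
      have hsub : uIcc u v ⊆ Ioo x y := ordConnected_Ioo.uIcc_subset hu hv
      rw [intervalIntegral.integral_eq_sub_of_hasDerivAt (f := Ψ) _ (hχi u v)]
      · calc |Ψ v - Ψ u| ≤ |Ψ v| + |Ψ u| := abs_sub _ _
          _ ≤ lam⁻¹ ^ N * M + lam⁻¹ ^ N * M :=
            add_le_add (h v (hIoo hv).1 (hIoo hv).2).2.1 (h u (hIoo hu).1 (hIoo hu).2).2.1
          _ = 2 * lam⁻¹ ^ N * M := by ring
      · intro t ht
        have htG := hIoo (hsub ht)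
        rw [hχG t htG]
        exact (h t htG.1 htG.2).1
    have hy' : y ∈ closure (Ioo x y) := by rw [closure_Ioo hxy.ne]; exact ⟨hxy.le, le_rfl⟩
    have hx' : x ∈ closure (Ioo x y) := by rw [closure_Ioo hxy.ne]; exact ⟨le_rfl, hxy.le⟩
    have hright : ∀ u ∈ Ioo x y, |∫ t in u..y, χ t| ≤ 2 * lam⁻¹ ^ N * M := fun u hu =>
      le_on_closure (hinner u hu)
        (intervalIntegral.continuous_primitive hχi u).abs.continuousOn continuousOn_const hy'
    simp only [fun u => intervalIntegral.integral_symm (f := χ) (μ := volume) y u, abs_neg]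
      at hright ⊢
    exact le_on_closure hright
      (intervalIntegral.continuous_primitive hχi y).abs.continuousOn continuousOn_const hx'
  obtain ⟨c, hcm, hcb, hcp, -⟩ := H' χ hχi _ hgap
  have hmain := hν (fun x => χ x - c x) (hχm.sub hcm)
    ⟨(b + C * M) + C' * (2 * lam⁻¹ ^ N * M), fun x =>
      (abs_sub _ _).trans (add_le_add (hχb x) (hcb x))⟩ _ hcp
  have hνac : ν ≪ volume.restrict (Icc (0 : ℝ) 1) :=
    (Measure.absolutelyContinuous_of_le hν.le_smul).trans Measure.smul_absolutelyContinuous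
  have hνG : ∀ᵐ x ∂ν, x ∈ G := by
    refine hνac.ae_le ?_
    filter_upwards [ae_restrict_mem measurableSet_Icc,
      ae_restrict_of_ae (T.finite_toSet.countable.ae_notMem volume)] with x hx hxT
    exact ⟨hx, hxT⟩
  rw [integral_map hfN.aemeasurable hφ.measurable.aestronglyMeasurable]
  have hi1 : Integrable (fun x => φ (f^[N] x)) ν :=
    integrable_of_measurable_of_abs_le (hφ.measurable.comp hfN) fun x => hb _
  have hi2 : Integrable (fun x => χ x - c x) ν :=
    (integrable_of_measurable_of_abs_le hχm hχb).sub (integrable_of_measurable_of_abs_le hcm hcb)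
  have herr : |∫ x, φ (f^[N] x) ∂ν - ∫ x, (χ x - c x) ∂ν| ≤
      C * M + C' * (2 * lam⁻¹ ^ N * M) := by
    rw [← integral_sub hi1 hi2, ← Real.norm_eq_abs]
    refine (norm_integral_le_of_norm_le_const (C := C * M + C' * (2 * lam⁻¹ ^ N * M)) ?_).trans
      (by simp)
    filter_upwards [hνG] with x hx
    have h1 := (h x hx.1 hx.2).2.2
    rw [← hχG x hx] at h1
    have h2 := hcb x
    rw [Real.norm_eq_abs]
    rw [abs_le] at h1 h2 ⊢
    constructor <;> linarith [h1.1, h1.2, h2.1, h2.2]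
  calc |∫ x, φ (f^[N] x) ∂ν|
      ≤ |∫ x, φ (f^[N] x) ∂ν - ∫ x, (χ x - c x) ∂ν| + |∫ x, (χ x - c x) ∂ν| := by
        simpa using abs_add_le (∫ x, φ (f^[N] x) ∂ν - ∫ x, (χ x - c x) ∂ν)
          (∫ x, (χ x - c x) ∂ν)
    _ ≤ (C * M + C' * (2 * lam⁻¹ ^ N * M)) + V * (2 * lam⁻¹ ^ N * M) := add_le_add herr hmain
    _ = _ := by ring

theorem exists_hasVariationBound_iterate (hf : IsExpandingOff f S lam B) (hlam : 1 < lam)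
    (hB : 0 ≤ B) :
    ∃ W, ∀ n, HasVariationBound W ((volume.restrict (Icc (0 : ℝ) 1)).map f^[n]) := by
  have hlam0 : 0 < lam := one_pos.trans hlam
  set m : Measure ℝ := volume.restrict (Icc (0 : ℝ) 1) with hm
  have hmp : IsProbabilityMeasure m := ⟨by simp [hm]⟩
  have hprob : ∀ n, IsProbabilityMeasure (m.map f^[n]) := fun n =>
    Measure.isProbabilityMeasure_map (hf.measurable.iterate n).aemeasurable
  have hmap : ∀ j n, m.map f^[j + n] = (m.map f^[n]).map f^[j] := fun j n => by
    rw [Measure.map_map (hf.measurable.iterate j) (hf.measurable.iterate n), Function.iterate_add]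
  choose C hC H using hf.exists_hasVariationBound_map hlam hB
  obtain ⟨N, hN⟩ := exists_pow_lt_of_lt_one (show (0 : ℝ) < 1 / 4 by norm_num)
    (inv_lt_one_of_one_lt₀ hlam)
  have hNpos : 0 < N := by
    rcases Nat.eq_zero_or_pos N with rfl | h
    · norm_num at hN
    · exact h
  set V := max 1 (2 * C N) with hVdef
  have hV : 0 ≤ V := zero_le_one.trans (le_max_left _ _)
  have hblock : ∀ q, HasVariationBound V (m.map f^[N * q]) := by
    intro q
    induction q with
    | zero =>
      simpa [Measure.map_id] using hasVariationBound_volume_restrict.mono (le_max_left 1 (2 * C N))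
    | succ q ih =>
      rw [mul_add, mul_one, add_comm, hmap]
      refine (H N (m.map f^[N * q]) V hV ih).mono ?_
      have h1 : 2 * C N ≤ V := le_max_right _ _
      nlinarith
  refine ⟨∑ r ∈ Finset.range N, (2 * lam⁻¹ ^ r * V + C r), fun n => ?_⟩
  rw [← Nat.mod_add_div n N, hmap]
  refine (H (n % N) _ V hV (hblock (n / N))).mono ?_
  refine Finset.single_le_sum (f := fun r => 2 * lam⁻¹ ^ r * V + C r) (fun r _ => ?_)
    (Finset.mem_range.2 (Nat.mod_lt n hNpos))
  have := hC r
  positivity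

theorem exists_invariant (hf : IsExpandingOff f S lam B) (hlam : 1 < lam) (hB : 0 ≤ B) :
    ∃ μ : Measure ℝ, IsProbabilityMeasure μ ∧ μ.map f = μ ∧
      μ ≪ volume.restrict (Icc (0 : ℝ) 1) := by
  have : IsProbabilityMeasure (volume.restrict (Icc (0 : ℝ) 1)) := ⟨by simp⟩
  obtain ⟨W, hW⟩ := hf.exists_hasVariationBound_iterate hlam hB
  refine exists_invariant_of_iterate_map_le_smul _ hf.measurable (ENNReal.ofReal W)
    ENNReal.ofReal_ne_top fun n => ?_
  have := Measure.isProbabilityMeasure_map (μ := volume.restrict (Icc (0 : ℝ) 1))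
    (hf.measurable.iterate n).aemeasurable
  exact (hW n).le_smul

end IsExpandingOff

theorem exists_mem_Ioo_of_notMem_range {k : ℕ} (a : Fin (k + 1) → ℝ) {x : ℝ} (h0 : a 0 ≤ x)
    (hx : x ∉ range a) (j : Fin (k + 1)) (hj : x ≤ a j) :
    ∃ i : Fin k, x ∈ Ioo (a i.castSucc) (a i.succ) := by
  induction j using Fin.induction with
  | zero => exact absurd ⟨0, le_antisymm h0 hj⟩ hx
  | succ i ih =>
    rcases le_or_gt x (a i.castSucc) with h | h
    · exact ih h
    · exact ⟨i, h, hj.lt_of_ne fun he => hx ⟨_, he.symm⟩⟩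

/-- The derivative of a `C²` function on a compact interval is differentiable in the interior,
with bounded derivative. -/
theorem _root_.ContDiffOn.exists_abs_deriv_deriv_le {G : ℝ → ℝ} {p q : ℝ}
    (hG : ContDiffOn ℝ 2 G (Icc p q)) (hpq : p < q) :
    ∃ B, ∀ x ∈ Ioo p q, DifferentiableAt ℝ G x ∧ DifferentiableAt ℝ (deriv G) x ∧
      |deriv (deriv G) x| ≤ B := by
  have hu := uniqueDiffOn_Icc hpq
  have h1 : ContDiffOn ℝ 1 (derivWithin G (Icc p q)) (Icc p q) :=
    hG.derivWithin hu (by norm_num)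
  have h2 : ContinuousOn (derivWithin (derivWithin G (Icc p q)) (Icc p q)) (Icc p q) :=
    (h1.derivWithin (m := 0) hu (by norm_num)).continuousOn
  obtain ⟨B, hB⟩ := isCompact_Icc.exists_bound_of_continuousOn h2
  refine ⟨B, fun x hx => ?_⟩
  have hnhds : ∀ y ∈ Ioo p q, Icc p q ∈ 𝓝 y := fun y hy => Icc_mem_nhds hy.1 hy.2
  have heq : deriv G =ᶠ[𝓝 x] derivWithin G (Icc p q) := by
    filter_upwards [isOpen_Ioo.mem_nhds hx] with y hy
    exact (derivWithin_of_mem_nhds (hnhds y hy)).symm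
  refine ⟨(hG.contDiffAt (hnhds x hx)).differentiableAt (by norm_num),
    ((h1.contDiffAt (hnhds x hx)).differentiableAt (by norm_num)).congr_of_eventuallyEq heq, ?_⟩
  rw [heq.deriv_eq, ← derivWithin_of_mem_nhds (hnhds x hx)]
  exact hB x (Ioo_subset_Icc_self hx)

theorem injOn_Ioo_of_deriv_ne_zero {f : ℝ → ℝ} {p q : ℝ} (hf : ContinuousOn f (Ioo p q))
    (hd : ∀ x ∈ Ioo p q, deriv f x ≠ 0) : InjOn f (Ioo p q) := by
  have key : ∀ x ∈ Ioo p q, ∀ y ∈ Ioo p q, x < y → f x ≠ f y := by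
    intro x hx y hy hxy he
    obtain ⟨c, hc, hc0⟩ := exists_deriv_eq_zero hxy
      (hf.mono fun t ht => ⟨hx.1.trans_le ht.1, ht.2.trans_lt hy.2⟩) he
    exact hd c ⟨hx.1.trans hc.1, hc.2.trans hy.2⟩ hc0
  intro x hx y hy he
  rcases lt_trichotomy x y with h | h | h
  · exact absurd he (key x hx y hy h)
  · exact h
  · exact absurd he.symm (key y hy x hx h)

/-- A piecewise `C²` expanding map agrees, off the partition points, with an everywhere defined
Borel map of the kind considered in `IsExpandingOff`. -/
theorem exists_isExpandingOff {k : ℕ} (a : Fin (k + 1) → ℝ)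
    (ha0 : a 0 = 0) (hak : a (Fin.last k) = 1) (hmono : StrictMono a)
    {g : ℝ → ℝ} (hmaps : MapsTo g (Icc 0 1) (Icc 0 1))
    (hC2 : ∀ i : Fin k, ∃ G : ℝ → ℝ,
      ContDiffOn ℝ 2 G (Icc (a i.castSucc) (a i.succ)) ∧
      EqOn g G (Ioo (a i.castSucc) (a i.succ)))
    {lam : ℝ} (hlam : 1 < lam)
    (hexp : ∀ i : Fin k, ∀ x ∈ Ioo (a i.castSucc) (a i.succ), lam ≤ |deriv g x|) :
    ∃ (f : ℝ → ℝ) (S : Finset ℝ) (B : ℝ), 0 ≤ B ∧ IsExpandingOff f S lam B ∧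
      ∀ x ∈ Icc (0 : ℝ) 1, x ∉ S → f x = g x := by
  classical
  choose G hG hgG using hC2
  have hlt : ∀ i : Fin k, a i.castSucc < a i.succ := fun i => hmono i.castSucc_lt_succ
  choose B hB using fun i => (hG i).exists_abs_deriv_deriv_le (hlt i)
  set U : Set ℝ := ⋃ i : Fin k, Ioo (a i.castSucc) (a i.succ) with hU
  have hUo : IsOpen U := isOpen_iUnion fun i => isOpen_Ioo
  set S : Finset ℝ := Finset.univ.image a with hS
  have hpiece : ∀ x ∈ Icc (0 : ℝ) 1, x ∉ S → ∃ i : Fin k, x ∈ Ioo (a i.castSucc) (a i.succ) := by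
    intro x hx hxS
    refine exists_mem_Ioo_of_notMem_range a (ha0.trans_le hx.1) ?_ (Fin.last k)
      (hx.2.trans_eq hak.symm)
    simpa [hS] using hxS
  have hU01 : U ⊆ Icc 0 1 := by
    refine iUnion_subset fun i x hx => ⟨?_, ?_⟩
    · rw [← ha0]
      exact (hmono.monotone (Fin.zero_le _)).trans hx.1.le
    · rw [← hak]
      exact hx.2.le.trans (hmono.monotone (Fin.le_last _))
  have hnear : ∀ i : Fin k, ∀ x ∈ Ioo (a i.castSucc) (a i.succ), U.indicator g =ᶠ[𝓝 x] g := by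
    intro i x hx
    filter_upwards [hUo.mem_nhds (mem_iUnion.2 ⟨i, hx⟩)] with y hy
    exact indicator_of_mem hy g
  have hnearG : ∀ i : Fin k, ∀ x ∈ Ioo (a i.castSucc) (a i.succ), U.indicator g =ᶠ[𝓝 x] G i := by
    intro i x hx
    filter_upwards [hnear i x hx, isOpen_Ioo.mem_nhds hx] with y hy hyi
    exact hy.trans (hgG i hyi)
  have hdiff : ∀ i : Fin k, ∀ x ∈ Ioo (a i.castSucc) (a i.succ),
      DifferentiableAt ℝ (U.indicator g) x := fun i x hx =>
    (hB i x hx).1.congr_of_eventuallyEq (hnearG i x hx)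
  have hle : ∀ i : Fin k, ∀ x ∈ Ioo (a i.castSucc) (a i.succ), lam ≤ |deriv (U.indicator g) x| :=
    fun i x hx => by
      rw [(hnear i x hx).deriv_eq]
      exact hexp i x hx
  refine ⟨U.indicator g, S, ∑ i, |B i|, Finset.sum_nonneg fun _ _ => abs_nonneg _, ?_, ?_⟩
  · refine ⟨?_, ?_, ?_, ?_, ?_, ?_, ?_⟩
    · have hcont : ContinuousOn (U.indicator g) U := by
        intro x hx
        obtain ⟨i, hi⟩ := mem_iUnion.1 hx
        exact (hdiff i x hi).continuousAt.continuousWithinAt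
      have h0 : ContinuousOn (U.indicator g) Uᶜ :=
        (continuousOn_const (c := (0 : ℝ))).congr fun x hx => indicator_of_notMem hx g
      have := hcont.measurable_piecewise h0 hUo.measurableSet
      rwa [piecewise_same] at this
    · intro x
      by_cases hx : x ∈ U
      · rw [indicator_of_mem hx]
        exact hmaps (hU01 hx)
      · rw [indicator_of_notMem hx]
        simp
    · intro x hx hxS
      obtain ⟨i, hi⟩ := hpiece x hx hxS
      exact hdiff i x hi
    · intro x hx hxS
      obtain ⟨i, hi⟩ := hpiece x hx hxS
      exact (hB i x hi).2.1.congr_of_eventuallyEq (hnearG i x hi).deriv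
    · intro x hx hxS
      obtain ⟨i, hi⟩ := hpiece x hx hxS
      exact hle i x hi
    · intro x hx hxS
      obtain ⟨i, hi⟩ := hpiece x hx hxS
      rw [(hnearG i x hi).deriv.deriv_eq]
      exact ((hB i x hi).2.2.trans (le_abs_self _)).trans
        (Finset.single_le_sum (f := fun i => |B i|) (fun _ _ => abs_nonneg _) (Finset.mem_univ i))
    · intro y
      refine Finite.subset (s := ⋃ i : Fin k, {x | x ∈ Ioo (a i.castSucc) (a i.succ) ∧
        U.indicator g x = y}) (finite_iUnion fun i => Set.Subsingleton.finite ?_) ?_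
      · intro x hx z hz
        refine injOn_Ioo_of_deriv_ne_zero (f := U.indicator g)
          (fun t ht => (hdiff i t ht).continuousAt.continuousWithinAt) (fun t ht => ?_)
          hx.1 hz.1 (hx.2.trans hz.2.symm)
        exact abs_pos.1 ((one_pos.trans hlam).trans_le (hle i t ht))
      · rintro x ⟨hx, hxS, hxy⟩
        obtain ⟨i, hi⟩ := hpiece x hx hxS
        exact mem_iUnion.2 ⟨i, hi, hxy⟩
  · intro x hx hxS
    obtain ⟨i, hi⟩ := hpiece x hx hxS
    exact (hnear i x hi).eq_of_nhds

end LasotaYorke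

/-- Lasota–Yorke: a piecewise `C²`, uniformly expanding map of `[0,1]` (with respect to a
finite partition `0 = a₀ < a₁ < ⋯ < a_k = 1`, with `|g'| ≥ λ > 1` on each open piece and
a `C²` extension to each closed piece) admits an invariant Borel probability measure on
`[0,1]` which is absolutely continuous with respect to Lebesgue measure. -/
theorem exists_acip_of_piecewise_expanding
    (k : ℕ) (a : Fin (k + 1) → ℝ)
    (ha0 : a 0 = 0) (hak : a (Fin.last k) = 1) (hmono : StrictMono a)
    (g : ℝ → ℝ) (hmaps : Set.MapsTo g (Set.Icc 0 1) (Set.Icc 0 1))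
    (hC2 : ∀ i : Fin k, ∃ G : ℝ → ℝ,
      ContDiffOn ℝ 2 G (Set.Icc (a i.castSucc) (a i.succ)) ∧
      Set.EqOn g G (Set.Ioo (a i.castSucc) (a i.succ)))
    (lam : ℝ) (hlam : 1 < lam)
    (hexp : ∀ i : Fin k, ∀ x ∈ Set.Ioo (a i.castSucc) (a i.succ), lam ≤ |deriv g x|) :
    ∃ μ : Measure ℝ, IsProbabilityMeasure μ ∧ μ (Set.Icc (0 : ℝ) 1) = 1 ∧
      Measure.map g μ = μ ∧ μ ≪ volume := by
  obtain ⟨f, S, B, hB, hf, hfg⟩ :=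
    LasotaYorke.exists_isExpandingOff a ha0 hak hmono hmaps hC2 hlam hexp
  obtain ⟨μ, hμ, hinv, hac⟩ := hf.exists_invariant hlam hB
  have hmem : ∀ᵐ x ∂μ, x ∈ Set.Icc (0 : ℝ) 1 := hac.ae_le (ae_restrict_mem measurableSet_Icc)
  have hvol : μ ≪ volume := hac.trans Measure.absolutelyContinuous_restrict
  have hS : ∀ᵐ x ∂μ, x ∉ S := hvol.ae_le (S.finite_toSet.countable.ae_notMem volume)
  refine ⟨μ, hμ, (prob_compl_eq_zero_iff measurableSet_Icc).1 hmem, ?_, hvol⟩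
  refine (Measure.map_congr ?_).trans hinv
  filter_upwards [hmem, hS] with x hx hxS
  exact (hfg x hx hxS).symm
end
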